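/- arXiv:1903.02961 — 2 statements merged into one kernel-verified Lean document; each statement's English description precedes it below -/
import Mathlib

section
/- Let (X,μ) and (Y,ν) be σ-finite measure spaces, let m₁ : X → (0,∞) and m₂ : Y → (0,∞) be measurable weights, let 1 ≤ p ≤ ∞, and let k : X×Y → ℂ be measurable. Set C := ess sup_{x∈X} m₁(x)⁻¹ ‖k(x,·)·m₂‖_{L^p(ν)}. If C < ∞, then for every f ∈ L¹_{m₁}(μ) the integral T_k f(y) = ∫_X k(x,y) f(x) dμ(x) converges absolutely for ν-almost every y, T_k f ∈ L^p_{m₂}(ν), and ‖T_k f‖_{L^p_{m₂}(ν)} ≤ C ‖f‖_{L¹_{m₁}(μ)}. Conversely, if there is a constant C′ such that T_k f is defined ν-a.e. and ‖T_k f‖_{L^p_{m₂}(ν)} ≤ C′ ‖f‖_{L¹_{m₁}(μ)} for all f ∈ L¹_{m₁}(μ), then C ≤ C′. In particular, T_k is bounded from L¹_{m₁}(μ) to L^p_{m₂}(ν) if and only if C < ∞, and in that case its operator norm equals C. -/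
open MeasureTheory ENNReal

/-- The horizontal sections of a product-measurable set are all measurable with respect to a single
countably generated σ-algebra. -/
lemma exists_countable_generating_sections {X Y : Type*} [MeasurableSpace X] [MeasurableSpace Y]
    {S : Set (X × Y)} (hS : MeasurableSet S) :
    ∃ b : Set (Set X), b.Countable ∧ (∀ s ∈ b, MeasurableSet s) ∧
      ∀ y, MeasurableSet[MeasurableSpace.generateFrom b] ((fun x => (x, y)) ⁻¹' S) := by
  rw [← generateFrom_prod] at hS
  induction S, hS using MeasurableSpace.generateFrom_induction with
  | hC S hS _ =>
    obtain ⟨s, hs, u, -, rfl⟩ := hS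
    refine ⟨{s}, Set.countable_singleton s, by simpa using hs, fun y => ?_⟩
    by_cases hy : y ∈ u
    · have : (fun x => (x, y)) ⁻¹' (s ×ˢ u) = s := by ext; simp [hy]
      rw [this]
      exact MeasurableSpace.measurableSet_generateFrom rfl
    · have : (fun x => (x, y)) ⁻¹' (s ×ˢ u) = ∅ := by ext; simp [hy]
      rw [this]
      exact MeasurableSpace.measurableSet_empty _
  | empty => exact ⟨∅, Set.countable_empty, by simp, fun y => MeasurableSpace.measurableSet_empty _⟩
  | compl S _ ih =>
    obtain ⟨b, hb, hbm, h⟩ := ih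
    exact ⟨b, hb, hbm, fun y => (h y).compl⟩
  | iUnion S _ ih =>
    choose b hb hbm h using ih
    refine ⟨⋃ n, b n, Set.countable_iUnion hb, by simpa using fun s n => hbm n s, fun y => ?_⟩
    rw [Set.preimage_iUnion]
    exact MeasurableSet.iUnion fun n =>
      MeasurableSpace.generateFrom_mono (Set.subset_iUnion b n) _ (h n y)

/-- The horizontal sections of a product-measurable function with values in a countably generated
space are all measurable with respect to a single countably generated σ-algebra. -/
lemma exists_seq_measurable_sections {X Y Z : Type*} [MeasurableSpace X] [MeasurableSpace Y]
    [MeasurableSpace Z] [MeasurableSpace.CountablyGenerated Z] {K : X × Y → Z}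
    (hK : Measurable K) :
    ∃ t : ℕ → Set X, (∀ n, MeasurableSet (t n)) ∧
      ∀ y, Measurable[MeasurableSpace.generateFrom (Set.range t)] (fun x => K (x, y)) := by
  have hc : Countable (MeasurableSpace.countableGeneratingSet Z) :=
    MeasurableSpace.countable_countableGeneratingSet
  choose b hb hbm h using fun s : MeasurableSpace.countableGeneratingSet Z =>
    exists_countable_generating_sections
      (hK (MeasurableSpace.measurableSet_countableGeneratingSet s.2))
  obtain ⟨t, ht⟩ := ((Set.countable_iUnion hb).insert ∅).exists_eq_range (Set.insert_nonempty _ _)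
  refine ⟨t, fun n => ?_, fun y => ?_⟩
  · have : t n ∈ insert ∅ (⋃ s, b s) := ht ▸ Set.mem_range_self n
    rcases this with h0 | h1
    · rw [h0]; exact MeasurableSet.empty
    · obtain ⟨s, hs⟩ := Set.mem_iUnion.1 h1
      exact hbm s _ hs
  · rw [← ht]
    have hgen := @measurable_generateFrom _ _
      (MeasurableSpace.generateFrom (insert ∅ (⋃ s, b s)))
      (MeasurableSpace.countableGeneratingSet Z) (fun x => K (x, y)) fun s hs =>
        MeasurableSpace.generateFrom_mono
          ((Set.subset_iUnion b ⟨s, hs⟩).trans (Set.subset_insert _ _)) _ (h ⟨s, hs⟩ y)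
    rwa [MeasurableSpace.generateFrom_countableGeneratingSet] at hgen

/-- Averaging over the cells of a finite partition is a conditional expectation. -/
lemma setAverage_memPartitionSet_ae_eq_condExp {X : Type*} [MeasurableSpace X] {μ : Measure X}
    [IsFiniteMeasure μ] {t : ℕ → Set X} (ht : ∀ n, MeasurableSet (t n)) {g : X → ℝ}
    (hg : Integrable g μ) (n : ℕ) :
    (fun x => ⨍ z in memPartitionSet t n x, g z ∂μ)
      =ᵐ[μ] μ[g | ProbabilityTheory.partitionFiltration ht n] := by
  have hm := (ProbabilityTheory.partitionFiltration ht).le n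
  have hfin : Finite (memPartition t n) := (finite_memPartition t n)
  have hcell : ∀ F : memPartition t n → ℝ, Measurable[ProbabilityTheory.partitionFiltration ht n]
      (fun x => F ⟨memPartitionSet t n x, memPartitionSet_mem t n x⟩) := fun F =>
    measurable_from_top.comp (ProbabilityTheory.measurable_memPartitionSet_subtype ht n ⊤)
  have hmeas := hcell fun s => ⨍ z in (s : Set X), g z ∂μ
  have hint : Integrable (fun x => ⨍ z in memPartitionSet t n x, g z ∂μ) μ := by
    obtain ⟨M, hM⟩ := (Set.finite_range
      (fun s : memPartition t n => ‖⨍ z in (s : Set X), g z ∂μ‖)).bddAbove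
    refine Integrable.of_bound (hmeas.mono hm le_rfl).aestronglyMeasurable M (ae_of_all _ fun x => ?_)
    exact hM ⟨⟨_, memPartitionSet_mem t n x⟩, rfl⟩
  refine ae_eq_condExp_of_forall_setIntegral_eq hm hg (fun s _ _ => hint.integrableOn) ?_
    hmeas.stronglyMeasurable.aestronglyMeasurable
  intro s hs _
  obtain ⟨S, hS, rfl⟩ := (MeasurableSpace.measurableSet_generateFrom_memPartition_iff t n s).1 hs
  have hSm : ∀ s ∈ S, MeasurableSet s := fun s hs =>
    MeasurableSpace.measurableSet_memPartition ht n (hS hs)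
  have hSd : Set.Pairwise (S : Set (Set X)) (Function.onFun Disjoint fun s => s) :=
    fun s hs u hu hsu => disjoint_memPartition t n (hS hs) (hS hu) hsu
  rw [Set.sUnion_eq_biUnion]
  simp only [Finset.mem_coe]
  rw [integral_biUnion_finset S hSm hSd (fun _ _ => hint.integrableOn),
    integral_biUnion_finset S hSm hSd (fun _ _ => hg.integrableOn)]
  refine Finset.sum_congr rfl fun s hs => ?_
  have : Set.EqOn (fun x => ⨍ z in memPartitionSet t n x, g z ∂μ)
      (fun _ => ⨍ z in s, g z ∂μ) s := fun x hx => by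
    simp only [memPartitionSet_of_mem (hS hs) hx]
  rw [setIntegral_congr_fun (hSm s hs) this, setIntegral_const,
    measure_smul_setAverage _ (measure_ne_top μ s)]

/-- Averages over the cells of refining partitions converge almost everywhere, for functions that
are measurable with respect to the σ-algebra generated by the partitions. -/
lemma ae_tendsto_setAverage_memPartitionSet {X : Type*} [MeasurableSpace X] {μ : Measure X}
    [IsFiniteMeasure μ] {t : ℕ → Set X} (ht : ∀ n, MeasurableSet (t n)) {g : X → ℂ}
    (hg : Integrable g μ) (hgt : Measurable[MeasurableSpace.generateFrom (Set.range t)] g) :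
    ∀ᵐ x ∂μ, Filter.Tendsto (fun n => ⨍ z in memPartitionSet t n x, g z ∂μ) Filter.atTop
      (nhds (g x)) := by
  have key : ∀ {h : X → ℝ}, Integrable h μ →
      Measurable[MeasurableSpace.generateFrom (Set.range t)] h →
      ∀ᵐ x ∂μ, Filter.Tendsto (fun n => ⨍ z in memPartitionSet t n x, h z ∂μ) Filter.atTop
        (nhds (h x)) := by
    intro h hh hht
    rw [← ProbabilityTheory.iSup_partitionFiltration_eq_generateFrom_range ht] at hht
    filter_upwards [hh.tendsto_ae_condExp hht.stronglyMeasurable,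
      ae_all_iff.2 (setAverage_memPartitionSet_ae_eq_condExp ht hh)] with x hx hx'
    simpa only [hx'] using hx
  filter_upwards [key hg.re (Complex.measurable_re.comp hgt),
    key hg.im (Complex.measurable_im.comp hgt)] with x hre him
  have hsplit : ∀ n, (⨍ z in memPartitionSet t n x, g z ∂μ) =
      ((⨍ z in memPartitionSet t n x, RCLike.re (g z) ∂μ : ℝ) : ℂ) +
      ((⨍ z in memPartitionSet t n x, RCLike.im (g z) ∂μ : ℝ) : ℂ) * Complex.I := fun n => by
    rw [setAverage_eq, setAverage_eq, setAverage_eq,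
      ← integral_re_add_im (hg.integrableOn (s := memPartitionSet t n x))]
    simp
    ring
  simp_rw [hsplit]
  have := ((Complex.continuous_ofReal.tendsto _).comp hre).add
    (((Complex.continuous_ofReal.tendsto _).comp him).mul_const Complex.I)
  simpa using this

/-- Minkowski's integral inequality for a kernel with uniformly bounded `L^p` sections. -/
lemma eLpNorm_lintegral_le_mul_measure_univ {X Y : Type*} [MeasurableSpace X] [MeasurableSpace Y]
    {σ : Measure X} {ν : Measure Y} [SFinite σ] [SFinite ν] {p : ℝ≥0∞} (hp : 1 ≤ p)
    {G : X × Y → ℝ≥0∞} (hG : Measurable G) {C : ℝ≥0∞}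
    (hC : ∀ᵐ x ∂σ, eLpNorm (fun y => G (x, y)) p ν ≤ C) :
    eLpNorm (fun y => ∫⁻ x, G (x, y) ∂σ) p ν ≤ C * σ Set.univ := by
  rcases eq_or_ne p ∞ with rfl | hp_top
  · have hle : ∀ᵐ x ∂σ, ∀ᵐ y ∂ν, G (x, y) ≤ C := by
      filter_upwards [hC] with x hx
      filter_upwards [enorm_ae_le_eLpNormEssSup (fun y => G (x, y)) ν] with y hy
      exact hy.trans (by simpa using hx)
    rw [Measure.ae_ae_comm (p := fun x y => G (x, y) ≤ C)
      (measurableSet_le hG measurable_const)] at hle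
    rw [eLpNorm_exponent_top]
    refine eLpNormEssSup_le_of_ae_enorm_bound ?_
    filter_upwards [hle] with y hy
    rw [enorm_eq_self, ← lintegral_const]
    exact lintegral_mono_ae hy
  · have hp0 : p ≠ 0 := (zero_lt_one.trans_le hp).ne'
    have hr : 1 ≤ p.toReal := by simpa using ENNReal.toReal_mono hp_top hp
    have hr0 : 0 < p.toReal := zero_lt_one.trans_le hr
    have holder : ∀ y, (∫⁻ x, G (x, y) ∂σ) ^ p.toReal ≤
        (∫⁻ x, G (x, y) ^ p.toReal ∂σ) * σ Set.univ ^ (p.toReal - 1) := fun y => by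
      have h := eLpNorm'_le_eLpNorm'_mul_rpow_measure_univ (μ := σ) zero_lt_one hr
        (hG.comp (measurable_prodMk_right (y := y))).aestronglyMeasurable
      simp only [eLpNorm', enorm_eq_self, Function.comp_apply, ENNReal.rpow_one, div_one] at h
      calc (∫⁻ x, G (x, y) ∂σ) ^ p.toReal ≤ _ := ENNReal.rpow_le_rpow h hr0.le
        _ = _ := by
          rw [ENNReal.mul_rpow_of_nonneg _ _ hr0.le, ← ENNReal.rpow_mul, ← ENNReal.rpow_mul,
            one_div_mul_cancel hr0.ne', ENNReal.rpow_one, sub_mul, one_div_mul_cancel hr0.ne',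
            one_mul]
    have hsec : ∀ᵐ x ∂σ, ∫⁻ y, G (x, y) ^ p.toReal ∂ν ≤ C ^ p.toReal := by
      filter_upwards [hC] with x hx
      rw [eLpNorm_eq_lintegral_rpow_enorm_toReal hp0 hp_top, one_div,
        ENNReal.rpow_inv_le_iff hr0] at hx
      simpa using hx
    rw [eLpNorm_eq_lintegral_rpow_enorm_toReal hp0 hp_top, one_div, ENNReal.rpow_inv_le_iff hr0]
    simp only [enorm_eq_self]
    have hGp : Measurable fun z => G z ^ p.toReal := hG.pow_const _
    calc ∫⁻ y, (∫⁻ x, G (x, y) ∂σ) ^ p.toReal ∂ν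
        ≤ ∫⁻ y, (∫⁻ x, G (x, y) ^ p.toReal ∂σ) * σ Set.univ ^ (p.toReal - 1) ∂ν :=
          lintegral_mono holder
      _ = (∫⁻ x, ∫⁻ y, G (x, y) ^ p.toReal ∂ν ∂σ) * σ Set.univ ^ (p.toReal - 1) := by
          rw [lintegral_mul_const _ hGp.lintegral_prod_left',
            lintegral_lintegral_swap (f := fun x y => G (x, y) ^ p.toReal) hGp.aemeasurable]
      _ ≤ (∫⁻ _, C ^ p.toReal ∂σ) * σ Set.univ ^ (p.toReal - 1) := by
          gcongr ?_ * _
          exact lintegral_mono_ae hsec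
      _ = (C * σ Set.univ) ^ p.toReal := by
          rw [lintegral_const, mul_assoc, ENNReal.mul_rpow_of_nonneg _ _ hr0.le]
          congr 1
          nth_rw 1 [← ENNReal.rpow_one (σ Set.univ)]
          rw [← ENNReal.rpow_add_of_nonneg _ _ zero_le_one (sub_nonneg.2 hr)]
          congr 1; ring

/-- Averages of a measurable kernel over the cells of a finite partition are jointly measurable. -/
lemma measurable_setAverage_memPartitionSet {X Y : Type*} [MeasurableSpace X] [MeasurableSpace Y]
    {μ : Measure X} [SFinite μ] {t : ℕ → Set X} (ht : ∀ n, MeasurableSet (t n)) {K : X × Y → ℂ}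
    (hK : Measurable K) (n : ℕ) :
    Measurable fun q : X × Y => ⨍ z in memPartitionSet t n q.1, K (z, q.2) ∂μ := by
  have hfin : Finite (memPartition t n) := finite_memPartition t n
  let _ : MeasurableSpace (memPartition t n) := ⊤
  have hF : Measurable fun q : memPartition t n × Y => ⨍ z in (q.1 : Set X), K (z, q.2) ∂μ := by
    refine measurable_from_prod_countable_right fun s => ?_
    simp only [setAverage_eq]
    exact (hK.stronglyMeasurable.integral_prod_left'
      (μ := μ.restrict (s : Set X))).measurable.const_smul _
  have hcomp : ∀ F : memPartition t n × Y → ℂ, Measurable F → Measurable fun q : X × Y =>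
      F (⟨memPartitionSet t n q.1, memPartitionSet_mem t n q.1⟩, q.2) := fun F hF =>
    hF.comp ((((ProbabilityTheory.measurable_memPartitionSet_subtype ht n ⊤).mono
      ((ProbabilityTheory.partitionFiltration ht).le n) le_rfl).comp measurable_fst).prodMk
        measurable_snd)
  exact hcomp _ hF

/-- If the averages of a kernel over all measurable sets are bounded in `L^p`, then so are almost all
of its sections. -/
lemma ae_eLpNorm_section_le_of_forall_setIntegral {X Y : Type*} [MeasurableSpace X]
    [MeasurableSpace Y] {μ : Measure X} {ν : Measure Y} [IsFiniteMeasure μ] [SFinite ν]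
    {p : ℝ≥0∞} {K : X × Y → ℂ} (hK : Measurable K) {C : ℝ≥0∞}
    (hint : ∀ᵐ y ∂ν, Integrable (fun x => K (x, y)) μ)
    (hC : ∀ E, MeasurableSet E →
      eLpNorm (fun y => ∫ x in E, K (x, y) ∂μ) p ν ≤ C * μ E) :
    ∀ᵐ x ∂μ, eLpNorm (fun y => K (x, y)) p ν ≤ C := by
  obtain ⟨t, ht, hKt⟩ := exists_seq_measurable_sections hK
  have hmeas := measurable_setAverage_memPartitionSet (μ := μ) ht hK
  have hlim : ∀ᵐ y ∂ν, ∀ᵐ x ∂μ, Filter.Tendsto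
      (fun n => (⨍ z in memPartitionSet t n x, K (z, y) ∂μ) - K (x, y)) Filter.atTop (nhds 0) := by
    filter_upwards [hint] with y hy
    filter_upwards [ae_tendsto_setAverage_memPartitionSet ht hy (hKt y)] with x hx
    simpa using hx.sub_const (K (x, y))
  rw [← Measure.ae_ae_comm (p := fun x y => Filter.Tendsto
    (fun n => (⨍ z in memPartitionSet t n x, K (z, y) ∂μ) - K (x, y)) Filter.atTop (nhds 0))
    (measurableSet_tendsto _ fun n => (hmeas n).sub hK)] at hlim
  filter_upwards [hlim] with x hx
  have hbound : ∀ n, eLpNorm (fun y => ⨍ z in memPartitionSet t n x, K (z, y) ∂μ) p ν ≤ C := by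
    intro n
    have hE := hC _ (MeasurableSpace.measurableSet_memPartitionSet ht n x)
    set E := memPartitionSet t n x
    simp only [setAverage_eq]
    refine (eLpNorm_const_smul (μ.real E)⁻¹ (fun y => ∫ z in E, K (z, y) ∂μ) p ν).trans_le ?_
    rcases eq_or_ne (μ E) 0 with h0 | h0
    · simp [measureReal_def, h0]
    · have hr : 0 < μ.real E := ENNReal.toReal_pos h0 (measure_ne_top μ E)
      rw [enorm_inv hr.ne', Real.enorm_of_nonneg hr.le, ofReal_measureReal, mul_comm,
        ← div_eq_mul_inv]
      exact ENNReal.div_le_of_le_mul hE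
  refine (Lp.eLpNorm_lim_le_liminf_eLpNorm
    (f := fun n y => ⨍ z in memPartitionSet t n x, K (z, y) ∂μ)
    (fun n => ((hmeas n).comp measurable_prodMk_left).aestronglyMeasurable) _ ?_).trans ?_
  · filter_upwards [hx] with y hy
    simpa using hy.add_const (K (x, y))
  · exact (Filter.liminf_le_liminf (Filter.Eventually.of_forall hbound)).trans_eq
      (Filter.liminf_const C)

lemma ae_lt_top_of_eLpNorm_lt_top {Y : Type*} [MeasurableSpace Y] {ν : Measure Y} {p : ℝ≥0∞}
    (hp : p ≠ 0) {g : Y → ℝ≥0∞} (hg : AEMeasurable g ν) (h : eLpNorm g p ν < ∞) :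
    ∀ᵐ y ∂ν, g y < ∞ := by
  rcases eq_or_ne p ∞ with rfl | hp_top
  · filter_upwards [enorm_ae_le_eLpNormEssSup g ν] with y hy
    exact (hy.trans_eq eLpNorm_exponent_top.symm).trans_lt h
  · have hr := ENNReal.toReal_pos hp hp_top
    filter_upwards [ae_lt_top' (hg.enorm.pow_const _)
      (lintegral_rpow_enorm_lt_top_of_eLpNorm_lt_top hp hp_top h).ne] with y hy
    simpa [ENNReal.rpow_lt_top_iff_of_pos hr] using hy

/-- The normalised kernel `m₁(x)⁻¹ m₂(y) k(x, y)`, which turns a weighted bound into an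
unweighted one. -/
noncomputable def weightedKernel {X Y : Type*} (m₁ : X → ℝ) (m₂ : Y → ℝ) (k : X × Y → ℂ)
    (q : X × Y) : ℂ :=
  (m₁ q.1)⁻¹ • m₂ q.2 • k q

lemma measurable_weightedKernel {X Y : Type*} [MeasurableSpace X] [MeasurableSpace Y]
    {m₁ : X → ℝ} {m₂ : Y → ℝ} {k : X × Y → ℂ} (hm₁ : Measurable m₁) (hm₂ : Measurable m₂)
    (hk : Measurable k) : Measurable (weightedKernel m₁ m₂ k) :=
  (hm₁.comp measurable_fst).inv.smul ((hm₂.comp measurable_snd).smul hk)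

lemma eLpNorm_weightedKernel_section {X Y : Type*} [MeasurableSpace Y] {ν : Measure Y}
    {m₁ : X → ℝ} (m₂ : Y → ℝ) (k : X × Y → ℂ) {x : X} (hx : 0 < m₁ x) (p : ℝ≥0∞) :
    eLpNorm (fun y => weightedKernel m₁ m₂ k (x, y)) p ν =
      (ENNReal.ofReal (m₁ x))⁻¹ * eLpNorm (fun y => m₂ y • k (x, y)) p ν := by
  refine (eLpNorm_const_smul (m₁ x)⁻¹ (fun y => m₂ y • k (x, y)) p ν).trans ?_
  rw [enorm_inv hx.ne', Real.enorm_of_nonneg hx.le]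

/-- Sufficiency in the Schur test: a uniform weighted `L^p` bound on the sections of the kernel
bounds the integral operator on weighted `L¹`. -/
lemma integralOperator_bound_of_ae_section_bound {X Y : Type*} [MeasurableSpace X]
    [MeasurableSpace Y] {μ : Measure X} {ν : Measure Y} [SFinite ν]
    {m₁ : X → ℝ} {m₂ : Y → ℝ} (hm₁ : Measurable m₁) (hm₂ : Measurable m₂)
    (hm₁pos : ∀ x, 0 < m₁ x) (hm₂pos : ∀ y, 0 < m₂ y) {p : ℝ≥0∞} (hp : 1 ≤ p)
    {k : X × Y → ℂ} (hk : Measurable k) {C : ℝ≥0∞} (hCtop : C < ∞)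
    (hC : ∀ᵐ x ∂μ, eLpNorm (fun y => weightedKernel m₁ m₂ k (x, y)) p ν ≤ C)
    {f : X → ℂ} (hf : AEStronglyMeasurable f μ)
    (hfin : eLpNorm (fun x => m₁ x • f x) 1 μ < ∞) :
    (∀ᵐ y ∂ν, Integrable (fun x => k (x, y) * f x) μ) ∧
      eLpNorm (fun y => m₂ y • ∫ x, k (x, y) * f x ∂μ) p ν
        ≤ C * eLpNorm (fun x => m₁ x • f x) 1 μ := by
  have hF : AEMeasurable (fun x => ‖m₁ x • f x‖ₑ) μ :=
    (hm₁.aestronglyMeasurable.smul hf).enorm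
  rw [eLpNorm_one_eq_lintegral_enorm] at hfin ⊢
  set σ := μ.withDensity fun x => ‖m₁ x • f x‖ₑ with hσ
  have hσfin : IsFiniteMeasure σ := isFiniteMeasure_withDensity hfin.ne
  have hσuniv : σ Set.univ = ∫⁻ x, ‖m₁ x • f x‖ₑ ∂μ := by
    rw [hσ, withDensity_apply _ MeasurableSet.univ, Measure.restrict_univ]
  have hK := measurable_weightedKernel hm₁ hm₂ hk
  have hI : ∀ y, ∫⁻ x, ‖weightedKernel m₁ m₂ k (x, y)‖ₑ ∂σ =
      ‖m₂ y‖ₑ * ∫⁻ x, ‖k (x, y) * f x‖ₑ ∂μ := fun y => by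
    have hKy : Measurable fun x => ‖weightedKernel m₁ m₂ k (x, y)‖ₑ :=
      (hK.comp measurable_prodMk_right).enorm
    rw [hσ, lintegral_withDensity_eq_lintegral_mul₀ hF hKy.aemeasurable,
      ← lintegral_const_mul' _ _ enorm_ne_top]
    refine lintegral_congr fun x => ?_
    rw [Pi.mul_apply, ← enorm_mul, ← enorm_smul]
    congr 1
    have : (m₁ x : ℂ) ≠ 0 := by exact_mod_cast (hm₁pos x).ne'
    simp only [weightedKernel, Complex.real_smul, Complex.ofReal_inv]
    field_simp
  have hbound : eLpNorm (fun y => ‖m₂ y‖ₑ * ∫⁻ x, ‖k (x, y) * f x‖ₑ ∂μ) p ν ≤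
      C * ∫⁻ x, ‖m₁ x • f x‖ₑ ∂μ := by
    rw [← hσuniv]
    simp only [← hI]
    refine eLpNorm_lintegral_le_mul_measure_univ hp hK.enorm ?_
    filter_upwards [(withDensity_absolutelyContinuous μ _).ae_le hC] with x hx
    rwa [eLpNorm_enorm]
  have hmeas : Measurable fun y => ‖m₂ y‖ₑ * ∫⁻ x, ‖k (x, y) * f x‖ₑ ∂μ := by
    simp only [← hI]
    exact hK.enorm.lintegral_prod_left'
  refine ⟨?_, (eLpNorm_mono_enorm fun y => ?_).trans hbound⟩
  · filter_upwards [ae_lt_top_of_eLpNorm_lt_top (zero_lt_one.trans_le hp).ne' hmeas.aemeasurable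
      (hbound.trans_lt (ENNReal.mul_lt_top hCtop hfin))] with y hy
    refine ⟨(hk.comp measurable_prodMk_right).aestronglyMeasurable.mul hf, ?_⟩
    exact lt_top_of_mul_ne_top_right hy.ne (enorm_ne_zero.2 (hm₂pos y).ne')
  · rw [enorm_smul, enorm_eq_self]
    gcongr
    exact enorm_integral_le_lintegral_enorm _

/-- Necessity in the Schur test: a bound for the integral operator on weighted `L¹` bounds the
weighted `L^p` norm of almost every section of the kernel. -/
lemma ae_section_bound_of_integralOperator_bound {X Y : Type*} [MeasurableSpace X]
    [MeasurableSpace Y] {μ : Measure X} {ν : Measure Y} [SigmaFinite μ] [SFinite ν]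
    {m₁ : X → ℝ} {m₂ : Y → ℝ} (hm₁ : Measurable m₁) (hm₂ : Measurable m₂)
    (hm₁pos : ∀ x, 0 < m₁ x) {p : ℝ≥0∞} {k : X × Y → ℂ} (hk : Measurable k) {C : ℝ≥0∞}
    (hC : ∀ f : X → ℂ, AEStronglyMeasurable f μ →
      eLpNorm (fun x => m₁ x • f x) 1 μ < ∞ →
      (∀ᵐ y ∂ν, Integrable (fun x => k (x, y) * f x) μ) ∧
      eLpNorm (fun y => m₂ y • ∫ x, k (x, y) * f x ∂μ) p ν
        ≤ C * eLpNorm (fun x => m₁ x • f x) 1 μ) :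
    ∀ᵐ x ∂μ, eLpNorm (fun y => weightedKernel m₁ m₂ k (x, y)) p ν ≤ C := by
  obtain ⟨w, hwpos, hw, hwint⟩ := exists_pos_lintegral_lt_of_sigmaFinite μ one_ne_zero
  set μ' := μ.withDensity fun x => (w x : ℝ≥0∞) with hμ'
  have hfin : IsFiniteMeasure μ' := isFiniteMeasure_withDensity (hwint.trans one_lt_top).ne
  have hac : μ ≪ μ' := withDensity_absolutelyContinuous' hw.coe_nnreal_ennreal.aemeasurable
    (ae_of_all _ fun x => by simpa using (hwpos x).ne')
  set φ : X → ℂ := fun x => ((w x * (m₁ x)⁻¹ : ℝ) : ℂ) with hφ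
  have hφm : Measurable φ :=
    Complex.measurable_ofReal.comp (hw.coe_nnreal_real.mul hm₁.inv)
  have hker : ∀ x y, w x • weightedKernel m₁ m₂ k (x, y) = m₂ y • (k (x, y) * φ x) := fun x y => by
    simp only [weightedKernel, hφ, NNReal.smul_def, Complex.real_smul, Complex.ofReal_mul]
    ring
  have hnorm : ∀ E, MeasurableSet E →
      eLpNorm (fun x => m₁ x • E.indicator φ x) 1 μ = μ' E := fun E hE => by
    rw [eLpNorm_one_eq_lintegral_enorm, hμ', withDensity_apply _ hE, ← lintegral_indicator hE]
    refine lintegral_congr fun x => ?_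
    by_cases hx : x ∈ E
    · have : (m₁ x : ℂ) ≠ 0 := by exact_mod_cast (hm₁pos x).ne'
      have hmul : m₁ x • φ x = ((w x : ℝ) : ℂ) := by
        simp only [hφ, Complex.real_smul, Complex.ofReal_mul, Complex.ofReal_inv]
        field_simp
      rw [Set.indicator_of_mem hx, Set.indicator_of_mem hx, hmul, enorm_eq_nnnorm]
      simp
    · simp [hx]
  have hop : ∀ E, MeasurableSet E → _ := fun E hE =>
    hC (E.indicator φ) (hφm.indicator hE).aestronglyMeasurable
      ((hnorm E hE).trans_lt (measure_lt_top μ' E))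
  refine hac.ae_le (ae_eLpNorm_section_le_of_forall_setIntegral
    (measurable_weightedKernel hm₁ hm₂ hk) ?_ fun E hE => ?_)
  · filter_upwards [(hop Set.univ MeasurableSet.univ).1] with y hy
    rw [hμ', integrable_withDensity_iff_integrable_smul hw]
    simp only [hker]
    simp only [Set.indicator_univ] at hy
    exact hy.smul (m₂ y)
  · rw [← hnorm E hE]
    refine le_of_eq_of_le ?_ (hop E hE).2
    congr 1 with y
    rw [hμ', setIntegral_withDensity_eq_setIntegral_smul hw _ hE]
    simp only [hker]
    rw [integral_smul, ← integral_indicator hE]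
    simp only [Set.indicator_mul_right]

/-- **Schur test, `L¹_{m₁} → L^p_{m₂}` version.**
Let `(X,μ)` and `(Y,ν)` be σ-finite measure spaces, `m₁, m₂` measurable positive weights,
`1 ≤ p ≤ ∞`, `k` a measurable kernel, and
`C := ess sup_x m₁(x)⁻¹ ‖k(x,·) m₂‖_{L^p(ν)}`.
If `C < ∞` then for every `f ∈ L¹_{m₁}(μ)` the integral `T_k f(y) = ∫ k(x,y) f(x) dμ(x)`
converges absolutely for ν-a.e. `y` and `‖T_k f‖_{L^p_{m₂}} ≤ C ‖f‖_{L¹_{m₁}}`.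
Conversely, any constant `C'` for which these conclusions hold for all `f ∈ L¹_{m₁}(μ)`
satisfies `C ≤ C'`.  In particular `T_k` is bounded iff `C < ∞`, with operator norm `C`. -/
theorem schur_test_L1_to_Lp
    {X Y : Type*} [MeasurableSpace X] [MeasurableSpace Y]
    (μ : Measure X) (ν : Measure Y) [SigmaFinite μ] [SigmaFinite ν]
    (m₁ : X → ℝ) (m₂ : Y → ℝ)
    (hm₁ : Measurable m₁) (hm₂ : Measurable m₂)
    (hm₁pos : ∀ x, 0 < m₁ x) (hm₂pos : ∀ y, 0 < m₂ y)
    (p : ℝ≥0∞) (hp : 1 ≤ p)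
    (k : X × Y → ℂ) (hk : Measurable k)
    (C : ℝ≥0∞)
    (hC : C = essSup (fun x =>
      (ENNReal.ofReal (m₁ x))⁻¹ * eLpNorm (fun y => m₂ y • k (x, y)) p ν) μ) :
    -- if `C < ∞`, then `T_k` maps `L¹_{m₁}(μ)` boundedly into `L^p_{m₂}(ν)` with norm `≤ C`
    (C < ⊤ → ∀ f : X → ℂ, AEStronglyMeasurable f μ →
        eLpNorm (fun x => m₁ x • f x) 1 μ < ⊤ →
        (∀ᵐ y ∂ν, Integrable (fun x => k (x, y) * f x) μ) ∧
        eLpNorm (fun y => m₂ y • ∫ x, k (x, y) * f x ∂μ) p ν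
          ≤ C * eLpNorm (fun x => m₁ x • f x) 1 μ)
      ∧
    -- conversely, any admissible bound `C'` dominates `C`
    (∀ C' : ℝ≥0∞,
        (∀ f : X → ℂ, AEStronglyMeasurable f μ →
          eLpNorm (fun x => m₁ x • f x) 1 μ < ⊤ →
          (∀ᵐ y ∂ν, Integrable (fun x => k (x, y) * f x) μ) ∧
          eLpNorm (fun y => m₂ y • ∫ x, k (x, y) * f x ∂μ) p ν
            ≤ C' * eLpNorm (fun x => m₁ x • f x) 1 μ) →
        C ≤ C')
      ∧
    -- in particular: boundedness holds iff `C < ∞`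
    ((∃ C' : ℝ≥0∞, C' < ⊤ ∧
        ∀ f : X → ℂ, AEStronglyMeasurable f μ →
          eLpNorm (fun x => m₁ x • f x) 1 μ < ⊤ →
          (∀ᵐ y ∂ν, Integrable (fun x => k (x, y) * f x) μ) ∧
          eLpNorm (fun y => m₂ y • ∫ x, k (x, y) * f x ∂μ) p ν
            ≤ C' * eLpNorm (fun x => m₁ x • f x) 1 μ) ↔ C < ⊤) := by
  subst hC
  simp only [← eLpNorm_weightedKernel_section m₂ k (hm₁pos _)]
  have necessity := fun (C' : ℝ≥0∞) hC' => essSup_le_of_ae_le C'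
    (ae_section_bound_of_integralOperator_bound (μ := μ) (ν := ν) (p := p) hm₁ hm₂ hm₁pos hk hC')
  refine ⟨fun hC f hf hfin => ?_, necessity, ?_, fun hC => ⟨_, hC, fun f hf hfin => ?_⟩⟩
  · exact integralOperator_bound_of_ae_section_bound hm₁ hm₂ hm₁pos hm₂pos hp hk hC
      (ENNReal.ae_le_essSup _) hf hfin
  · rintro ⟨C', hC'top, hC'⟩
    exact (necessity C' hC').trans_lt hC'top
  · exact integralOperator_bound_of_ae_section_bound hm₁ hm₂ hm₁pos hm₂pos hp hk hC
      (ENNReal.ae_le_essSup _) hf hfin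
end

section
/- Let (X,μ) and (Y,ν) be σ-finite measure spaces, m₁ : X → (0,∞) and m₂ : Y → (0,∞) measurable weights, and k : X×Y → ℂ measurable. Set C₁ := ess sup_{y∈Y} m₂(y) ∫_X |k(x,y)| m₁(x)⁻¹ dμ(x) and C₂ := ess sup_{x∈X} m₁(x)⁻¹ ∫_Y |k(x,y)| m₂(y) dν(y). Then the following are equivalent: (a) the integral operator T_k is bounded from L^p_{m₁}(μ) to L^p_{m₂}(ν) for every p ∈ [1,∞]; (b) T_k is bounded from L¹_{m₁}(μ) to L¹_{m₂}(ν) and from L^∞_{m₁}(μ) to L^∞_{m₂}(ν); (c) C₁ < ∞ and C₂ < ∞. Moreover, when (c) holds, ‖T_k f‖_{L^p_{m₂}(ν)} ≤ C₂^{1/p} C₁^{1−1/p} ‖f‖_{L^p_{m₁}(μ)} for every p ∈ [1,∞] and every f ∈ L^p_{m₁}(μ). -/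
open MeasureTheory ENNReal

/-- `T_k` maps `L^p_{m₁}(μ)` boundedly into `L^p_{m₂}(ν)`: for every `f` in the weighted
space, the defining integral converges absolutely ν-a.e. and the weighted `L^p` norm of
`T_k f` is controlled by a finite constant times that of `f`. -/
def SchurBoundedLp {X Y : Type*} [MeasurableSpace X] [MeasurableSpace Y]
    (μ : Measure X) (ν : Measure Y) (m₁ : X → ℝ) (m₂ : Y → ℝ)
    (k : X × Y → ℂ) (p : ℝ≥0∞) : Prop :=
  ∃ C : ℝ≥0∞, C < ⊤ ∧ ∀ f : X → ℂ, AEStronglyMeasurable f μ →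
    eLpNorm (fun x => m₁ x • f x) p μ < ⊤ →
    (∀ᵐ y ∂ν, Integrable (fun x => k (x, y) * f x) μ) ∧
    eLpNorm (fun y => m₂ y • ∫ x, k (x, y) * f x ∂μ) p ν
      ≤ C * eLpNorm (fun x => m₁ x • f x) p μ

theorem exists_countable_measurableSet_sections {X Y : Type*} [MeasurableSpace X]
    [MeasurableSpace Y] {S : Set (X × Y)} (hS : MeasurableSet S) :
    ∃ c : Set (Set X), c.Countable ∧ (∀ s ∈ c, MeasurableSet s) ∧
      ∀ y, MeasurableSet[MeasurableSpace.generateFrom c] ((fun x => (x, y)) ⁻¹' S) := by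
  rw [← generateFrom_prod] at hS
  induction S, hS using MeasurableSpace.generateFrom_induction with
  | hC t ht _ =>
    obtain ⟨A, hA, B, hB, rfl⟩ := ht
    refine ⟨{A}, Set.countable_singleton A, by simpa using hA, fun y => ?_⟩
    by_cases hy : y ∈ B
    · simpa [Set.mk_preimage_prod_left hy] using
        MeasurableSpace.measurableSet_generateFrom (Set.mem_singleton A)
    · simp [Set.mk_preimage_prod_left_eq_empty hy]
  | empty => exact ⟨∅, Set.countable_empty, by simp, by simp⟩
  | compl t _ ih =>
    obtain ⟨c, hc, hcm, h⟩ := ih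
    exact ⟨c, hc, hcm, fun y => (h y).compl⟩
  | iUnion s _ ih =>
    choose c hc hcm h using ih
    refine ⟨⋃ n, c n, Set.countable_iUnion hc, by simpa using fun s n => hcm n s, fun y => ?_⟩
    rw [Set.preimage_iUnion]
    exact MeasurableSet.iUnion fun n =>
      MeasurableSpace.generateFrom_mono (Set.subset_iUnion c n) _ (h n y)

theorem exists_countable_measurable_sections {X Y E : Type*} [MeasurableSpace X]
    [MeasurableSpace Y] [MeasurableSpace E] [MeasurableSpace.CountablyGenerated E]
    {F : X × Y → E} (hF : Measurable F) :
    ∃ c : Set (Set X), c.Countable ∧ (∀ s ∈ c, MeasurableSet s) ∧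
      ∀ y, Measurable[MeasurableSpace.generateFrom c] (fun x => F (x, y)) := by
  choose! c hc hcm h using fun (t : Set E) (ht : MeasurableSet t) =>
    exists_countable_measurableSet_sections (hF ht)
  have hm : ∀ t ∈ MeasurableSpace.countableGeneratingSet E, MeasurableSet t := fun t ht =>
    MeasurableSpace.measurableSet_countableGeneratingSet ht
  refine ⟨⋃ t ∈ MeasurableSpace.countableGeneratingSet E, c t,
    (MeasurableSpace.countable_countableGeneratingSet).biUnion fun t ht => hc t (hm t ht),
    ?_, fun y => ?_⟩
  · simp only [Set.mem_iUnion]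
    rintro s ⟨t, ht, hs⟩
    exact hcm t (hm t ht) s hs
  · have hy := @measurable_generateFrom _ _ (MeasurableSpace.generateFrom
      (⋃ t ∈ MeasurableSpace.countableGeneratingSet E, c t))
      (MeasurableSpace.countableGeneratingSet E) (fun x => F (x, y)) fun t ht =>
        MeasurableSpace.generateFrom_mono
          (Set.subset_biUnion_of_mem (u := c) ht) _ (h t (hm t ht) y)
    rwa [MeasurableSpace.generateFrom_countableGeneratingSet] at hy

theorem exists_seq_dense_integrable {X : Type*} [MeasurableSpace X]
    [MeasurableSpace.CountablyGenerated X] (μ : Measure X) [SigmaFinite μ] :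
    ∃ g : ℕ → X → ℂ, (∀ n, StronglyMeasurable (g n)) ∧ (∀ n, Integrable (g n) μ) ∧
      ∀ u : X → ℂ, Integrable u μ → ∀ ε : ℝ≥0∞, 0 < ε → ∃ n, ∫⁻ x, ‖u x - g n x‖ₑ ∂μ < ε := by
  have : Fact ((1 : ℝ≥0∞) ≠ ⊤) := ⟨one_ne_top⟩
  refine ⟨fun n => TopologicalSpace.denseSeq (Lp ℂ 1 μ) n, fun n => Lp.stronglyMeasurable _,
    fun n => L1.integrable_coeFn _, fun u hu ε hε => ?_⟩
  obtain ⟨n, hn⟩ := (TopologicalSpace.denseRange_denseSeq (Lp ℂ 1 μ)).exists_mem_open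
    (Metric.isOpen_eball (x := hu.toL1 u) (ε := ε)) ⟨_, Metric.mem_eball_self hε⟩
  refine ⟨n, ?_⟩
  rw [Metric.mem_eball, edist_comm, Lp.edist_def, eLpNorm_one_eq_lintegral_enorm] at hn
  refine lt_of_eq_of_lt (lintegral_congr_ae ?_) hn
  filter_upwards [hu.coeFn_toL1] with x hx
  rw [Pi.sub_apply, hx]

theorem exists_seq_dense_sections {X Y : Type*} [MeasurableSpace X] [MeasurableSpace Y]
    (μ : Measure X) [SigmaFinite μ] {F : X × Y → ℂ} (hF : Measurable F) :
    ∃ g : ℕ → X → ℂ, (∀ n, Measurable (g n)) ∧ (∀ n, Integrable (g n) μ) ∧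
      ∀ y, Integrable (fun x => F (x, y)) μ → ∀ ε : ℝ≥0∞, 0 < ε →
        ∃ n, ∫⁻ x, ‖F (x, y) - g n x‖ₑ ∂μ < ε := by
  obtain ⟨c, hc, hcm, hsec⟩ := exists_countable_measurable_sections hF
  set d := c ∪ Set.range (spanningSets μ)
  have hdm : ∀ s ∈ d, MeasurableSet s := by
    rintro s (hs | ⟨n, rfl⟩)
    · exact hcm s hs
    · exact measurableSet_spanningSets μ n
  have hm : MeasurableSpace.generateFrom d ≤ ‹MeasurableSpace X› :=
    MeasurableSpace.generateFrom_le hdm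
  have hσ : SigmaFinite (μ.trim hm) := by
    refine ⟨⟨⟨spanningSets μ, fun _ => trivial, fun n => ?_, iUnion_spanningSets μ⟩⟩⟩
    rw [trim_measurableSet_eq hm (MeasurableSpace.measurableSet_generateFrom (Or.inr ⟨n, rfl⟩))]
    exact measure_spanningSets_lt_top μ n
  have hcg : @MeasurableSpace.CountablyGenerated X (MeasurableSpace.generateFrom d) :=
    @MeasurableSpace.CountablyGenerated.mk _ (_)
      ⟨d, hc.union (Set.countable_range _), rfl⟩
  obtain ⟨g, hg, hgi, h⟩ := @exists_seq_dense_integrable X (MeasurableSpace.generateFrom d) hcg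
    (μ.trim hm) hσ
  refine ⟨g, fun n => ((hg n).mono hm).measurable,
    fun n => integrable_of_integrable_trim hm (hgi n), fun y hy ε hε => ?_⟩
  have hym : StronglyMeasurable[MeasurableSpace.generateFrom d] (fun x => F (x, y)) :=
    ((hsec y).mono (MeasurableSpace.generateFrom_mono Set.subset_union_left)
      le_rfl).stronglyMeasurable
  obtain ⟨n, hn⟩ := h _ (hy.trim hm hym) ε hε
  refine ⟨n, ?_⟩
  have htrim := lintegral_trim (μ := μ) hm (hym.sub (hg n)).enorm
  simp only [Pi.sub_apply] at htrim
  rwa [htrim] at hn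

/-- **Schur's test** for non-negative kernels. -/
theorem eLpNorm_lintegral_mul_le_of_schur {X Y : Type*} [MeasurableSpace X] [MeasurableSpace Y]
    {μ : Measure X} {ν : Measure Y} [SFinite μ] [SFinite ν] {κ : X × Y → ℝ≥0∞}
    (hκ : Measurable κ) {C₁ C₂ : ℝ≥0∞} (hC₁ : C₁ ≠ ⊤)
    (h₁ : ∀ᵐ y ∂ν, ∫⁻ x, κ (x, y) ∂μ ≤ C₁) (h₂ : ∀ᵐ x ∂μ, ∫⁻ y, κ (x, y) ∂ν ≤ C₂)
    {F : X → ℝ≥0∞} (hF : AEMeasurable F μ) {p : ℝ≥0∞} (hp : 1 ≤ p) :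
    eLpNorm (fun y => ∫⁻ x, κ (x, y) * F x ∂μ) p ν ≤
      C₂ ^ (1 / p).toReal * C₁ ^ (1 - (1 / p).toReal) * eLpNorm F p μ := by
  have hκx : ∀ y, Measurable fun x => κ (x, y) := fun y => hκ.comp measurable_prodMk_right
  have hκy : ∀ x, Measurable fun y => κ (x, y) := fun x => hκ.comp measurable_prodMk_left
  rcases eq_or_ne p ⊤ with rfl | hpt
  · simp only [div_top, toReal_zero, rpow_zero, sub_zero, rpow_one, one_mul,
      eLpNorm_exponent_top, eLpNormEssSup_eq_essSup_enorm, enorm_eq_self]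
    refine essSup_le_of_ae_le _ ?_
    filter_upwards [h₁] with y hy
    calc ∫⁻ x, κ (x, y) * F x ∂μ ≤ ∫⁻ x, κ (x, y) * essSup F μ ∂μ := by
          refine lintegral_mono_ae ?_
          filter_upwards [ae_le_essSup F] with x hx
          gcongr
      _ = (∫⁻ x, κ (x, y) ∂μ) * essSup F μ := lintegral_mul_const _ (hκx y)
      _ ≤ C₁ * essSup F μ := by gcongr
  have hp0 : p ≠ 0 := (zero_lt_one.trans_le hp).ne'
  set r := p.toReal with hr
  have hr1 : 1 ≤ r := by simpa using ENNReal.toReal_mono hpt hp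
  have hr0 : 0 < r := zero_lt_one.trans_le hr1
  have hpr : (1 / p).toReal = 1 / r := by simp [hr]
  have hq : 0 ≤ 1 - 1 / r := sub_nonneg.2 ((div_le_one hr0).2 hr1)
  rw [hpr, eLpNorm_eq_lintegral_rpow_enorm_toReal hp0 hpt,
    eLpNorm_eq_lintegral_rpow_enorm_toReal hp0 hpt]
  simp only [enorm_eq_self, ← hr]
  have hholder : ∀ᵐ y ∂ν, (∫⁻ x, κ (x, y) * F x ∂μ) ^ r ≤
      (∫⁻ x, κ (x, y) * F x ^ r ∂μ) * C₁ ^ (r - 1) := by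
    filter_upwards [h₁] with y hy
    have hsplit : ∀ x, κ (x, y) * F x =
        (κ (x, y) * F x ^ r) ^ (1 / r) * κ (x, y) ^ (1 - 1 / r) := by
      intro x
      rw [mul_rpow_of_nonneg _ _ (by positivity), ← rpow_mul, mul_one_div_cancel hr0.ne', rpow_one,
        mul_right_comm, ← rpow_add_of_nonneg _ _ (by positivity) hq, add_sub_cancel, rpow_one]
    have hle := lintegral_mul_norm_pow_le (μ := μ) (f := fun x => κ (x, y) * F x ^ r)
      ((hκx y).aemeasurable.mul (hF.pow_const r)) (hκx y).aemeasurable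
      (p := 1 / r) (by positivity) hq (by ring)
    calc (∫⁻ x, κ (x, y) * F x ∂μ) ^ r
        ≤ ((∫⁻ x, κ (x, y) * F x ^ r ∂μ) ^ (1 / r) * C₁ ^ (1 - 1 / r)) ^ r := by
          simp_rw [hsplit]
          gcongr
          exact hle.trans (by gcongr)
      _ = _ := by
          rw [mul_rpow_of_nonneg _ _ hr0.le, ← rpow_mul, ← rpow_mul, one_div_mul_cancel hr0.ne',
            rpow_one, sub_mul, one_div_mul_cancel hr0.ne', one_mul]
  have hmeas : AEMeasurable (Function.uncurry fun y x => κ (x, y) * F x ^ r) (ν.prod μ) :=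
    (hκ.comp measurable_swap).aemeasurable.mul
      ((hF.pow_const r).comp_quasiMeasurePreserving Measure.quasiMeasurePreserving_snd)
  calc (∫⁻ y, (∫⁻ x, κ (x, y) * F x ∂μ) ^ r ∂ν) ^ (1 / r)
      ≤ (∫⁻ y, (∫⁻ x, κ (x, y) * F x ^ r ∂μ) * C₁ ^ (r - 1) ∂ν) ^ (1 / r) := by
        gcongr ?_ ^ _
        exact lintegral_mono_ae hholder
    _ = ((∫⁻ x, ∫⁻ y, κ (x, y) * F x ^ r ∂ν ∂μ) * C₁ ^ (r - 1)) ^ (1 / r) := by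
        rw [lintegral_mul_const' _ _ (rpow_ne_top_of_nonneg (sub_nonneg.2 hr1) hC₁),
          lintegral_lintegral_swap hmeas]
    _ ≤ ((C₂ * ∫⁻ x, F x ^ r ∂μ) * C₁ ^ (r - 1)) ^ (1 / r) := by
        gcongr ?_ ^ _
        gcongr
        rw [← lintegral_const_mul'' _ (hF.pow_const r)]
        refine lintegral_mono_ae ?_
        filter_upwards [h₂] with x hx
        rw [lintegral_mul_const _ (hκy x)]
        gcongr
    _ = _ := by
        rw [mul_rpow_of_nonneg _ _ (by positivity), mul_rpow_of_nonneg _ _ (by positivity),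
          ← rpow_mul, sub_mul, mul_one_div_cancel hr0.ne', one_mul, mul_right_comm]

theorem integrable_and_eLpNorm_le_of_schur {X Y : Type*} [MeasurableSpace X] [MeasurableSpace Y]
    {μ : Measure X} {ν : Measure Y} [SigmaFinite μ] [SigmaFinite ν] {m₁ : X → ℝ} {m₂ : Y → ℝ}
    (hm₁ : Measurable m₁) (hm₂ : Measurable m₂)
    (hm₁pos : ∀ x, 0 < m₁ x) (hm₂pos : ∀ y, 0 < m₂ y)
    {k : X × Y → ℂ} (hk : Measurable k) {C₁ C₂ : ℝ≥0∞} (hC₁ : C₁ < ⊤) (hC₂ : C₂ < ⊤)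
    (h₁ : ∀ᵐ y ∂ν, ENNReal.ofReal (m₂ y) *
      ∫⁻ x, (‖k (x, y)‖₊ : ℝ≥0∞) * (ENNReal.ofReal (m₁ x))⁻¹ ∂μ ≤ C₁)
    (h₂ : ∀ᵐ x ∂μ, (ENNReal.ofReal (m₁ x))⁻¹ *
      ∫⁻ y, (‖k (x, y)‖₊ : ℝ≥0∞) * ENNReal.ofReal (m₂ y) ∂ν ≤ C₂)
    {p : ℝ≥0∞} (hp : 1 ≤ p) {f : X → ℂ} (hf : AEStronglyMeasurable f μ)
    (hfp : eLpNorm (fun x => m₁ x • f x) p μ < ⊤) :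
    (∀ᵐ y ∂ν, Integrable (fun x => k (x, y) * f x) μ) ∧
      eLpNorm (fun y => m₂ y • ∫ x, k (x, y) * f x ∂μ) p ν
        ≤ C₂ ^ (1 / p).toReal * C₁ ^ (1 - (1 / p).toReal) *
          eLpNorm (fun x => m₁ x • f x) p μ := by
  set κ : X × Y → ℝ≥0∞ := fun z =>
    ENNReal.ofReal (m₂ z.2) * (‖k z‖ₑ * (ENNReal.ofReal (m₁ z.1))⁻¹) with hκdef
  have hκ : Measurable κ := by fun_prop
  have hkx : ∀ y, Measurable fun x => k (x, y) := fun y => hk.comp measurable_prodMk_right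
  have h₁' : ∀ᵐ y ∂ν, ∫⁻ x, κ (x, y) ∂μ ≤ C₁ := by
    filter_upwards [h₁] with y hy
    exact (lintegral_const_mul' _ _ ofReal_ne_top).trans_le hy
  have h₂' : ∀ᵐ x ∂μ, ∫⁻ y, κ (x, y) ∂ν ≤ C₂ := by
    filter_upwards [h₂] with x hx
    rw [← lintegral_const_mul' _ _ (by simpa using hm₁pos x)] at hx
    refine (lintegral_congr fun y => ?_).trans_le hx
    simp only [hκdef, enorm_eq_nnnorm]
    ring
  set F : X → ℝ≥0∞ := fun x => ‖m₁ x • f x‖ₑ with hFdef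
  have hF : AEMeasurable F μ := (hm₁.aestronglyMeasurable.smul hf).enorm
  have hFnorm : eLpNorm F p μ = eLpNorm (fun x => m₁ x • f x) p μ := eLpNorm_enorm _
  have hker : ∀ x y, κ (x, y) * F x = ENNReal.ofReal (m₂ y) * ‖k (x, y) * f x‖ₑ := by
    intro x y
    have : (ENNReal.ofReal (m₁ x))⁻¹ * ENNReal.ofReal (m₁ x) = 1 :=
      ENNReal.inv_mul_cancel (by simpa using hm₁pos x) ofReal_ne_top
    simp only [hκdef, hFdef, enorm_smul, enorm_mul, Real.enorm_of_nonneg (hm₁pos x).le]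
    calc _ = ENNReal.ofReal (m₂ y) * (‖k (x, y)‖ₑ * ‖f x‖ₑ) *
          ((ENNReal.ofReal (m₁ x))⁻¹ * ENNReal.ofReal (m₁ x)) := by ring
      _ = _ := by rw [this, mul_one]
  have hkF : ∀ y, ∫⁻ x, κ (x, y) * F x ∂μ =
      ENNReal.ofReal (m₂ y) * ∫⁻ x, ‖k (x, y) * f x‖ₑ ∂μ := by
    intro y
    simp_rw [hker]
    exact lintegral_const_mul' _ _ ofReal_ne_top
  have hschur := eLpNorm_lintegral_mul_le_of_schur hκ hC₁.ne h₁' h₂' hF hp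
  rw [hFnorm] at hschur
  have hexp : 0 ≤ 1 - (1 / p).toReal := by
    rw [sub_nonneg]
    simpa using ENNReal.toReal_mono one_ne_top (ENNReal.inv_le_one.2 hp)
  constructor
  · have hp0 : p ≠ 0 := (zero_lt_one.trans_le hp).ne'
    have hlt : eLpNorm (fun y => ∫⁻ x, κ (x, y) * F x ∂μ) p ν < ⊤ :=
      hschur.trans_lt (mul_lt_top (mul_lt_top (rpow_lt_top_of_nonneg toReal_nonneg hC₂.ne)
        (rpow_lt_top_of_nonneg hexp hC₁.ne)) hfp)
    have hmeas : AEMeasurable (fun y => ∫⁻ x, κ (x, y) * F x ∂μ) ν :=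
      AEMeasurable.lintegral_prod_right' (f := fun z : Y × X => κ (z.2, z.1) * F z.2)
        ((hκ.comp measurable_swap).aemeasurable.mul
          (hF.comp_quasiMeasurePreserving Measure.quasiMeasurePreserving_snd))
    have hfin : ∀ᵐ y ∂ν, ∫⁻ x, κ (x, y) * F x ∂μ < ⊤ := by
      rcases eq_or_ne p ⊤ with rfl | hpt
      · rw [eLpNorm_exponent_top, eLpNormEssSup_eq_essSup_enorm] at hlt
        filter_upwards [ae_lt_of_essSup_lt hlt] with y hy
        simpa using hy
      · have := lintegral_rpow_enorm_lt_top_of_eLpNorm_lt_top hp0 hpt hlt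
        filter_upwards [ae_lt_top' (hmeas.pow_const p.toReal) (by simpa using this.ne)] with y hy
        exact (rpow_lt_top_iff_of_pos (toReal_pos hp0 hpt)).1 hy
    filter_upwards [hfin] with y hy
    refine ⟨(hkx y).aestronglyMeasurable.mul hf, ?_⟩
    rw [hkF] at hy
    exact lt_top_of_mul_ne_top_right hy.ne (by simpa using hm₂pos y)
  · refine (eLpNorm_mono_enorm fun y => ?_).trans hschur
    rw [enorm_eq_self, hkF, enorm_smul, Real.enorm_of_nonneg (hm₂pos y).le]
    gcongr
    exact enorm_integral_le_lintegral_enorm _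

theorem lintegral_enorm_le_enorm_integral_mul_phase {X : Type*} [MeasurableSpace X]
    {μ : Measure X} {u g : X → ℂ} (hu : Integrable u μ) (hg : Integrable g μ) :
    ∫⁻ x, ‖u x‖ₑ ∂μ ≤
      ‖∫ x, u x * ((starRingEnd ℂ) (g x) / ‖g x‖) ∂μ‖ₑ + 2 * ∫⁻ x, ‖u x - g x‖ₑ ∂μ := by
  set σ : X → ℂ := fun x => (starRingEnd ℂ) (g x) / ‖g x‖ with hσ
  have hσm : AEStronglyMeasurable σ μ :=
    ((Complex.continuous_conj.comp_aestronglyMeasurable hg.1).aemeasurable.div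
      (Complex.continuous_ofReal.comp_aestronglyMeasurable
        hg.1.norm).aemeasurable).aestronglyMeasurable
  have hσ1 : ∀ x, ‖σ x‖ ≤ 1 := fun x => by simp [hσ, div_self_le_one]
  have hgσ : ∀ x, g x * σ x = ‖g x‖ := by
    intro x
    rcases eq_or_ne (g x) 0 with h | h
    · simp [h]
    · have : (‖g x‖ : ℂ) ≠ 0 := by simpa using h
      simp only [hσ]
      rw [← mul_div_assoc, Complex.mul_conj', div_eq_iff this, sq]
  have huσ : Integrable (fun x => u x * σ x) μ :=
    hu.mul_bdd (c := 1) hσm (.of_forall hσ1)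
  have hdσ : Integrable (fun x => (g x - u x) * σ x) μ :=
    (hg.sub hu).mul_bdd (c := 1) hσm (.of_forall hσ1)
  have hgnorm : ∫⁻ x, ‖g x‖ₑ ∂μ = ‖∫ x, g x * σ x ∂μ‖ₑ := by
    simp_rw [hgσ, integral_complex_ofReal]
    rw [← ofReal_integral_norm_eq_lintegral_enorm hg, ← ofReal_norm, Complex.norm_real,
      Real.norm_of_nonneg (integral_nonneg fun _ => norm_nonneg _)]
  have hdiff : ‖∫ x, (g x - u x) * σ x ∂μ‖ₑ ≤ ∫⁻ x, ‖u x - g x‖ₑ ∂μ := by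
    refine (enorm_integral_le_lintegral_enorm _).trans (lintegral_mono fun x => ?_)
    rw [enorm_mul, enorm_sub_rev]
    exact mul_le_of_le_one_right' ((ofReal_norm _).symm.trans_le (ofReal_le_one.2 (hσ1 x)))
  calc ∫⁻ x, ‖u x‖ₑ ∂μ ≤ ∫⁻ x, (‖g x‖ₑ + ‖u x - g x‖ₑ) ∂μ := by
        refine lintegral_mono fun x => ?_
        simpa using enorm_add_le (g x) (u x - g x)
    _ = ∫⁻ x, ‖g x‖ₑ ∂μ + ∫⁻ x, ‖u x - g x‖ₑ ∂μ := lintegral_add_left' hg.1.enorm _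
    _ = ‖(∫ x, u x * σ x ∂μ) + ∫ x, (g x - u x) * σ x ∂μ‖ₑ + ∫⁻ x, ‖u x - g x‖ₑ ∂μ := by
        rw [hgnorm, ← integral_add huσ hdσ]
        congr! 4 with x
        ring
    _ ≤ ‖∫ x, u x * σ x ∂μ‖ₑ + ∫⁻ x, ‖u x - g x‖ₑ ∂μ + ∫⁻ x, ‖u x - g x‖ₑ ∂μ := by
        gcongr
        exact (enorm_add_le _ _).trans (by gcongr)
    _ = _ := by ring

theorem SchurBoundedLp.essSup_lt_top_of_top {X Y : Type*} [MeasurableSpace X] [MeasurableSpace Y]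
    {μ : Measure X} {ν : Measure Y} [SigmaFinite μ] {m₁ : X → ℝ} {m₂ : Y → ℝ}
    (hm₁ : Measurable m₁) (hm₁pos : ∀ x, 0 < m₁ x) (hm₂pos : ∀ y, 0 < m₂ y)
    {k : X × Y → ℂ} (hk : Measurable k) (h : SchurBoundedLp μ ν m₁ m₂ k ⊤) :
    essSup (fun y => ENNReal.ofReal (m₂ y) *
      ∫⁻ x, (‖k (x, y)‖₊ : ℝ≥0∞) * (ENNReal.ofReal (m₁ x))⁻¹ ∂μ) ν < ⊤ := by
  obtain ⟨C, hC, h⟩ := h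
  have htest : ∀ σ : X → ℂ, AEStronglyMeasurable σ μ → (∀ x, ‖σ x‖ ≤ 1) →
      ∀ᵐ y ∂ν, Integrable (fun x => k (x, y) * (m₁ x : ℂ)⁻¹ * σ x) μ ∧
        ENNReal.ofReal (m₂ y) * ‖∫ x, k (x, y) * (m₁ x : ℂ)⁻¹ * σ x ∂μ‖ₑ ≤ C := by
    intro σ hσ hσ1
    have hnorm : eLpNorm (fun x => m₁ x • ((m₁ x : ℂ)⁻¹ * σ x)) ⊤ μ ≤ 1 := by
      rw [eLpNorm_exponent_top]
      refine eLpNormEssSup_le_of_ae_enorm_bound (.of_forall fun x => ?_)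
      have hx : (m₁ x : ℂ) ≠ 0 := by exact_mod_cast (hm₁pos x).ne'
      rw [Complex.real_smul, mul_inv_cancel_left₀ hx, ← ofReal_norm]
      exact ofReal_le_one.2 (hσ1 x)
    obtain ⟨hint, hbd⟩ := h (fun x => (m₁ x : ℂ)⁻¹ * σ x)
      ((by fun_prop : Measurable fun x => (m₁ x : ℂ)⁻¹).aestronglyMeasurable.mul hσ)
      (hnorm.trans_lt one_lt_top)
    replace hbd := hbd.trans (mul_le_of_le_one_right' hnorm)
    rw [eLpNorm_exponent_top, eLpNormEssSup_eq_essSup_enorm] at hbd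
    filter_upwards [hint, ae_le_essSup (μ := ν)
      fun y => ‖m₂ y • ∫ x, k (x, y) * ((m₁ x : ℂ)⁻¹ * σ x) ∂μ‖ₑ] with y hy hy'
    simp_rw [← mul_assoc] at hy hy' hbd
    refine ⟨hy, ?_⟩
    rw [← Real.enorm_of_nonneg (hm₂pos y).le, ← enorm_smul]
    exact hy'.trans hbd
  have hFm : Measurable fun z : X × Y => k z * (m₁ z.1 : ℂ)⁻¹ := by fun_prop
  obtain ⟨g, hgm, hgi, hg⟩ := exists_seq_dense_sections μ hFm
  refine (essSup_le_of_ae_le C ?_).trans_lt hC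
  filter_upwards [htest (fun _ => 1) aestronglyMeasurable_const (by simp), ae_all_iff.2 fun n =>
    htest (fun x => (starRingEnd ℂ) (g n x) / ‖g n x‖)
      ((Complex.continuous_conj.measurable.comp (hgm n)).div
        (Complex.measurable_ofReal.comp (hgm n).norm)).aestronglyMeasurable
      (fun x => by simp [div_self_le_one])] with y hy hyn
  have hyi : Integrable (fun x => k (x, y) * (m₁ x : ℂ)⁻¹) μ := by simpa using hy.1
  have hm0 : ENNReal.ofReal (m₂ y) ≠ 0 := by simpa using hm₂pos y
  rw [mul_comm, ← ENNReal.le_div_iff_mul_le (.inl hm0) (.inl ofReal_ne_top)]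
  refine le_of_forall_pos_le_add fun ε hε _ => ?_
  obtain ⟨n, hn⟩ := hg y hyi (ε / 2) (by simpa using hε.ne')
  calc ∫⁻ x, (‖k (x, y)‖₊ : ℝ≥0∞) * (ENNReal.ofReal (m₁ x))⁻¹ ∂μ
      = ∫⁻ x, ‖k (x, y) * (m₁ x : ℂ)⁻¹‖ₑ ∂μ := by
        refine lintegral_congr fun x => ?_
        rw [enorm_mul, enorm_inv (by exact_mod_cast (hm₁pos x).ne'), ← ofReal_norm (m₁ x : ℂ),
          Complex.norm_real, Real.norm_of_nonneg (hm₁pos x).le]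
        rfl
    _ ≤ _ := lintegral_enorm_le_enorm_integral_mul_phase hyi (hgi n)
    _ ≤ C / ENNReal.ofReal (m₂ y) + 2 * (ε / 2) := by
        gcongr
        rw [ENNReal.le_div_iff_mul_le (.inl hm0) (.inl ofReal_ne_top), mul_comm]
        exact (hyn n).2
    _ = _ := by rw [ENNReal.mul_div_cancel two_ne_zero ofNat_ne_top]

theorem lintegral_enorm_le_of_section_near {X Y : Type*} [MeasurableSpace X]
    [MeasurableSpace Y] {μ : Measure X} {ν : Measure Y} [SFinite μ] [SFinite ν]
    {K : X × Y → ℂ} (hK : Measurable K) {C ε : ℝ≥0∞} {w : X → ℂ} (hw : Integrable w μ)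
    (hw0 : ∫⁻ x, ‖w x‖ₑ ∂μ ≠ 0) (hwnorm : ‖∫ x, w x ∂μ‖ₑ = ∫⁻ x, ‖w x‖ₑ ∂μ)
    (hint : ∀ᵐ y ∂ν, Integrable (fun x => K (x, y) * w x) μ)
    (hbd : ∫⁻ y, ‖∫ x, K (x, y) * w x ∂μ‖ₑ ∂ν ≤ C * ∫⁻ x, ‖w x‖ₑ ∂μ)
    {g : Y → ℂ} (hg : Measurable g)
    (hnear : ∀ x, w x ≠ 0 → ∫⁻ y, ‖K (x, y) - g y‖ₑ ∂ν ≤ ε) :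
    ∫⁻ y, ‖g y‖ₑ ∂ν ≤ C + ε := by
  set I := ∫⁻ x, ‖w x‖ₑ ∂μ with hI
  have hItop : I ≠ ⊤ := hw.2.ne
  have hD : AEMeasurable (fun z : X × Y => ‖K z - g z.2‖ₑ * ‖w z.1‖ₑ) (μ.prod ν) :=
    (hK.sub (hg.comp measurable_snd)).enorm.aemeasurable.mul
      (hw.1.enorm.comp_quasiMeasurePreserving Measure.quasiMeasurePreserving_fst)
  have hpt : ∀ᵐ y ∂ν, ‖g y‖ₑ * I ≤
      ‖∫ x, K (x, y) * w x ∂μ‖ₑ + ∫⁻ x, ‖K (x, y) - g y‖ₑ * ‖w x‖ₑ ∂μ := by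
    filter_upwards [hint] with y hy
    have hgw : Integrable (fun x => g y * w x) μ := hw.const_mul _
    have hsub : ∫ x, g y * w x ∂μ =
        (∫ x, K (x, y) * w x ∂μ) - ∫ x, (K (x, y) - g y) * w x ∂μ := by
      simp_rw [sub_mul]
      rw [integral_sub hy hgw, _root_.sub_sub_cancel]
    calc ‖g y‖ₑ * I = ‖∫ x, g y * w x ∂μ‖ₑ := by rw [integral_const_mul, enorm_mul, hwnorm]
      _ ≤ ‖∫ x, K (x, y) * w x ∂μ‖ₑ + ‖∫ x, (K (x, y) - g y) * w x ∂μ‖ₑ := by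
          rw [hsub]
          exact enorm_sub_le
      _ ≤ _ := by
          gcongr
          refine (enorm_integral_le_lintegral_enorm _).trans_eq (lintegral_congr fun x => ?_)
          rw [enorm_mul]
  have hfub : ∫⁻ y, ∫⁻ x, ‖K (x, y) - g y‖ₑ * ‖w x‖ₑ ∂μ ∂ν ≤ ε * I := by
    rw [← lintegral_lintegral_swap (f := fun x y => ‖K (x, y) - g y‖ₑ * ‖w x‖ₑ) hD, hI,
      ← lintegral_const_mul'' _ hw.1.enorm]
    refine lintegral_mono fun x => ?_
    rw [lintegral_mul_const' _ _ enorm_ne_top]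
    rcases eq_or_ne (w x) 0 with h | h
    · simp [h]
    · gcongr
      exact hnear x h
  have hmul : (∫⁻ y, ‖g y‖ₑ ∂ν) * I ≤ (C + ε) * I := by
    calc (∫⁻ y, ‖g y‖ₑ ∂ν) * I = ∫⁻ y, ‖g y‖ₑ * I ∂ν := (lintegral_mul_const' _ _ hItop).symm
      _ ≤ ∫⁻ y, (‖∫ x, K (x, y) * w x ∂μ‖ₑ + ∫⁻ x, ‖K (x, y) - g y‖ₑ * ‖w x‖ₑ ∂μ) ∂ν :=
          lintegral_mono_ae hpt
      _ = ∫⁻ y, ‖∫ x, K (x, y) * w x ∂μ‖ₑ ∂ν +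
          ∫⁻ y, ∫⁻ x, ‖K (x, y) - g y‖ₑ * ‖w x‖ₑ ∂μ ∂ν :=
          lintegral_add_right' _ hD.prod_swap.lintegral_prod_right'
      _ ≤ C * I + ε * I := add_le_add hbd hfub
      _ = _ := (add_mul _ _ _).symm
  exact (ENNReal.mul_le_mul_iff_left hw0 hItop).1 hmul

/-- The sections of the kernel of an operator bounded on `L¹` have almost
everywhere bounded `L¹` norms. -/
theorem ae_lintegral_enorm_le_of_L1_bound {X Y : Type*} [MeasurableSpace X] [MeasurableSpace Y]
    {μ : Measure X} {ν : Measure Y} [SigmaFinite μ] [SigmaFinite ν]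
    {K : X × Y → ℂ} (hK : Measurable K) {C : ℝ≥0∞}
    (hbd : ∀ w : X → ℂ, Integrable w μ → (∀ᵐ y ∂ν, Integrable (fun x => K (x, y) * w x) μ) ∧
      ∫⁻ y, ‖∫ x, K (x, y) * w x ∂μ‖ₑ ∂ν ≤ C * ∫⁻ x, ‖w x‖ₑ ∂μ)
    {ε : ℝ≥0∞} (hε : 0 < ε) :
    ∀ᵐ x ∂μ, ∫⁻ y, ‖K (x, y)‖ₑ ∂ν ≤ C + ε + ε := by
  obtain ⟨φ, hφ0, hφm, hφ⟩ := exists_pos_lintegral_lt_of_sigmaFinite μ one_ne_zero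
  have hφe : ∀ x, ‖((φ x : ℝ) : ℂ)‖ₑ = φ x := fun x => by
    rw [← ofReal_norm, Complex.norm_real, NNReal.norm_eq, ofReal_coe_nnreal]
  have hφi : Integrable (fun x => ((φ x : ℝ) : ℂ)) μ := by
    refine ⟨by fun_prop, ?_⟩
    simp_rw [HasFiniteIntegral, hφe]
    exact hφ.trans one_lt_top
  set H : Y → ℝ≥0∞ := fun y => ∫⁻ x, ‖K (x, y)‖ₑ * φ x ∂μ
  have hHm : Measurable H :=
    Measurable.lintegral_prod_left' (f := fun z : X × Y => ‖K z‖ₑ * φ z.1) (by fun_prop)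
  have hHfin : ∀ᵐ y ∂ν, H y < ⊤ := by
    filter_upwards [(hbd _ hφi).1] with y hy
    simpa [HasFiniteIntegral, enorm_mul, hφe] using hy.2
  set S : ℕ → Set Y := fun j => {y | H y ≤ j} ∩ spanningSets ν j
  have hSm : ∀ j, MeasurableSet (S j) := fun j =>
    (measurableSet_le hHm measurable_const).inter (measurableSet_spanningSets ν j)
  have hSmono : Monotone S := fun i j hij =>
    Set.inter_subset_inter (fun y (hy : H y ≤ i) => hy.trans (by exact_mod_cast hij))
      (monotone_spanningSets ν hij)
  have hSae : ∀ᵐ y ∂ν, y ∈ ⋃ j, S j := by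
    filter_upwards [hHfin] with y hy
    obtain ⟨i, hi⟩ := ENNReal.exists_nat_gt hy.ne
    obtain ⟨j, hj⟩ := Set.mem_iUnion.1 ((iUnion_spanningSets ν).symm ▸ Set.mem_univ y)
    refine Set.mem_iUnion.2 ⟨max i j, hi.le.trans (by exact_mod_cast le_max_left i j),
      monotone_spanningSets ν (le_max_right i j) hj⟩
  have hlocal : ∀ j, ∀ᵐ x ∂μ, ∫⁻ y in S j, ‖K (x, y)‖ₑ ∂ν ≤ C + ε + ε := by
    intro j
    have hsec : ∀ᵐ x ∂μ, Integrable (fun y => K (x, y)) (ν.restrict (S j)) := by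
      have hfin : ∫⁻ x, (∫⁻ y in S j, ‖K (x, y)‖ₑ ∂ν) * φ x ∂μ ≠ ⊤ := by
        simp_rw [← lintegral_mul_const' _ _ coe_ne_top]
        rw [lintegral_lintegral_swap (by fun_prop)]
        refine ((setLIntegral_mono measurable_const fun y hy => hy.1).trans_lt ?_).ne
        rw [setLIntegral_const]
        exact mul_lt_top (natCast_lt_top j)
          ((measure_mono Set.inter_subset_right).trans_lt (measure_spanningSets_lt_top ν j))
      have hmeas : Measurable fun x => (∫⁻ y in S j, ‖K (x, y)‖ₑ ∂ν) * φ x :=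
        (Measurable.lintegral_prod_right hK.enorm).mul hφm.coe_nnreal_ennreal
      filter_upwards [ae_lt_top hmeas hfin] with x hx
      exact ⟨(hK.comp measurable_prodMk_left).aestronglyMeasurable,
        lt_top_of_mul_ne_top_left hx.ne (by simpa using (hφ0 x).ne')⟩
    obtain ⟨g, hgm, hgi, hg⟩ :=
      exists_seq_dense_sections (ν.restrict (S j)) (hK.comp measurable_swap)
    set A : ℕ → Set X := fun n => {x | ∫⁻ y in S j, ‖K (x, y) - g n y‖ₑ ∂ν < ε}
    have hAm : ∀ n, MeasurableSet (A n) := fun n =>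
      measurableSet_lt (Measurable.lintegral_prod_right' (f := fun z : X × Y => ‖K z - g n z.2‖ₑ)
        (hK.sub ((hgm n).comp measurable_snd)).enorm) measurable_const
    have hAbd : ∀ n, μ (A n) ≠ 0 → ∫⁻ y in S j, ‖g n y‖ₑ ∂ν ≤ C + ε := by
      intro n hn
      set w : X → ℂ := (A n).indicator fun x => ((φ x : ℝ) : ℂ) with hw
      have hwr : ∀ x, w x = (((A n).indicator (fun x => (φ x : ℝ)) x : ℝ) : ℂ) := fun x => by
        by_cases hx : x ∈ A n <;> simp [hw, hx]
      have hwi : Integrable w μ := hφi.indicator (hAm n)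
      have hwe : ∫⁻ x, ‖w x‖ₑ ∂μ = ∫⁻ x in A n, φ x ∂μ := by
        rw [← lintegral_indicator (hAm n)]
        refine lintegral_congr fun x => ?_
        by_cases hx : x ∈ A n <;> simp [hw, hx, hφe]
      have hw0 : ∫⁻ x, ‖w x‖ₑ ∂μ ≠ 0 := by
        rw [hwe]
        exact ((setLIntegral_pos_iff hφm.coe_nnreal_ennreal).2 (by
          have : Function.support (fun x => (φ x : ℝ≥0∞)) = Set.univ := by
            ext x; simpa using (hφ0 x).ne'
          rw [this, Set.univ_inter]
          exact hn.bot_lt)).ne'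
      have hwnn : ∀ x, 0 ≤ (A n).indicator (fun x => (φ x : ℝ)) x := fun x =>
        Set.indicator_nonneg (fun x _ => (φ x).2) x
      have hwnorm : ‖∫ x, w x ∂μ‖ₑ = ∫⁻ x, ‖w x‖ₑ ∂μ := by
        rw [← ofReal_integral_norm_eq_lintegral_enorm hwi, ← ofReal_norm]
        simp_rw [hwr, integral_complex_ofReal, Complex.norm_real,
          Real.norm_of_nonneg (integral_nonneg hwnn), Real.norm_of_nonneg (hwnn _)]
      obtain ⟨hint, hle⟩ := hbd w hwi
      refine lintegral_enorm_le_of_section_near hK hwi hw0 hwnorm (ae_restrict_of_ae hint)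
        ((lintegral_mono' Measure.restrict_le_self le_rfl).trans hle) (hgm n) fun x hx => ?_
      exact (show x ∈ A n from Set.mem_of_indicator_ne_zero hx).le
    have hnull : ∀ᵐ x ∂μ, ∀ n, x ∈ A n → μ (A n) ≠ 0 := by
      refine ae_all_iff.2 fun n => ?_
      by_cases hn : μ (A n) = 0
      · filter_upwards [measure_eq_zero_iff_ae_notMem.1 hn] with x hx hx'
        exact absurd hx' hx
      · exact .of_forall fun _ _ => hn
    filter_upwards [hsec, hnull] with x hx hxn
    obtain ⟨n, hn⟩ := hg x hx ε hε
    calc ∫⁻ y in S j, ‖K (x, y)‖ₑ ∂ν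
        ≤ ∫⁻ y in S j, (‖g n y‖ₑ + ‖K (x, y) - g n y‖ₑ) ∂ν := by
          refine lintegral_mono fun y => ?_
          simpa using enorm_add_le (g n y) (K (x, y) - g n y)
      _ = _ := lintegral_add_left (hgm n).enorm _
      _ ≤ C + ε + ε := add_le_add (hAbd n (hxn n hn)) hn.le
  filter_upwards [ae_all_iff.2 hlocal] with x hx
  rw [← Measure.restrict_eq_self_of_ae_mem hSae,
    setLIntegral_iUnion_of_directed _ hSmono.directed_le]
  exact iSup_le hx

theorem SchurBoundedLp.essSup_lt_top_of_one {X Y : Type*} [MeasurableSpace X] [MeasurableSpace Y]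
    {μ : Measure X} {ν : Measure Y} [SigmaFinite μ] [SigmaFinite ν] {m₁ : X → ℝ} {m₂ : Y → ℝ}
    (hm₁ : Measurable m₁) (hm₂ : Measurable m₂)
    (hm₁pos : ∀ x, 0 < m₁ x) (hm₂pos : ∀ y, 0 < m₂ y)
    {k : X × Y → ℂ} (hk : Measurable k) (h : SchurBoundedLp μ ν m₁ m₂ k 1) :
    essSup (fun x => (ENNReal.ofReal (m₁ x))⁻¹ *
      ∫⁻ y, (‖k (x, y)‖₊ : ℝ≥0∞) * ENNReal.ofReal (m₂ y) ∂ν) μ < ⊤ := by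
  obtain ⟨C, hC, h⟩ := h
  have hne : ∀ x, (m₁ x : ℂ) ≠ 0 := fun x => by exact_mod_cast (hm₁pos x).ne'
  have hKm : Measurable fun z : X × Y => (m₂ z.2 : ℂ) * (k z * (m₁ z.1 : ℂ)⁻¹) := by fun_prop
  have hbd : ∀ w : X → ℂ, Integrable w μ →
      (∀ᵐ y ∂ν, Integrable (fun x => (m₂ y : ℂ) * (k (x, y) * (m₁ x : ℂ)⁻¹) * w x) μ) ∧
      ∫⁻ y, ‖∫ x, (m₂ y : ℂ) * (k (x, y) * (m₁ x : ℂ)⁻¹) * w x ∂μ‖ₑ ∂ν ≤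
        C * ∫⁻ x, ‖w x‖ₑ ∂μ := by
    intro w hw
    have hsm : (fun x => m₁ x • ((m₁ x : ℂ)⁻¹ * w x)) = w := by
      funext x
      rw [Complex.real_smul, mul_inv_cancel_left₀ (hne x)]
    have hassoc : ∀ x y, (m₂ y : ℂ) * (k (x, y) * (m₁ x : ℂ)⁻¹) * w x =
        (m₂ y : ℂ) * (k (x, y) * ((m₁ x : ℂ)⁻¹ * w x)) := fun x y => by ring
    have hw1 := h (fun x => (m₁ x : ℂ)⁻¹ * w x)
      ((by fun_prop : Measurable fun x => (m₁ x : ℂ)⁻¹).aestronglyMeasurable.mul hw.1)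
    rw [hsm, eLpNorm_one_eq_lintegral_enorm, eLpNorm_one_eq_lintegral_enorm] at hw1
    obtain ⟨hint, hle⟩ := hw1 hw.2
    simp_rw [hassoc, integral_const_mul]
    exact ⟨hint.mono fun y hy => hy.const_mul _, hle⟩
  refine (essSup_le_of_ae_le (C + 1 + 1) ?_).trans_lt (by simpa using hC)
  filter_upwards [ae_lintegral_enorm_le_of_L1_bound hKm hbd zero_lt_one] with x hx
  rw [← lintegral_const_mul' _ _ (by simpa using hm₁pos x)]
  refine (lintegral_congr fun y => ?_).trans_le hx
  rw [enorm_mul, enorm_mul, enorm_inv (hne x), ← ofReal_norm (m₁ x : ℂ), ← ofReal_norm (m₂ y : ℂ),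
    Complex.norm_real, Complex.norm_real, Real.norm_of_nonneg (hm₁pos x).le,
    Real.norm_of_nonneg (hm₂pos y).le, enorm_eq_nnnorm]
  ring

/-- **Schur test for simultaneous boundedness on all `L^p`, `1 ≤ p ≤ ∞`.**
With `C₁ := ess sup_y m₂(y) ∫ |k(x,y)| m₁(x)⁻¹ dμ(x)` and
`C₂ := ess sup_x m₁(x)⁻¹ ∫ |k(x,y)| m₂(y) dν(y)`, the following are equivalent:
(a) `T_k : L^p_{m₁}(μ) → L^p_{m₂}(ν)` is bounded for every `p ∈ [1,∞]`;
(b) `T_k` is bounded for `p = 1` and for `p = ∞`;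
(c) `C₁ < ∞` and `C₂ < ∞`.
Moreover, when (c) holds, `‖T_k f‖_{L^p_{m₂}} ≤ C₂^{1/p} C₁^{1-1/p} ‖f‖_{L^p_{m₁}}`. -/
theorem schur_test_all_p
    {X Y : Type*} [MeasurableSpace X] [MeasurableSpace Y]
    (μ : Measure X) (ν : Measure Y) [SigmaFinite μ] [SigmaFinite ν]
    (m₁ : X → ℝ) (m₂ : Y → ℝ)
    (hm₁ : Measurable m₁) (hm₂ : Measurable m₂)
    (hm₁pos : ∀ x, 0 < m₁ x) (hm₂pos : ∀ y, 0 < m₂ y)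
    (k : X × Y → ℂ) (hk : Measurable k)
    (C₁ C₂ : ℝ≥0∞)
    (hC₁ : C₁ = essSup (fun y => ENNReal.ofReal (m₂ y) *
      ∫⁻ x, (‖k (x, y)‖₊ : ℝ≥0∞) * (ENNReal.ofReal (m₁ x))⁻¹ ∂μ) ν)
    (hC₂ : C₂ = essSup (fun x => (ENNReal.ofReal (m₁ x))⁻¹ *
      ∫⁻ y, (‖k (x, y)‖₊ : ℝ≥0∞) * ENNReal.ofReal (m₂ y) ∂ν) μ) :
    -- (a) ↔ (b)
    ((∀ p : ℝ≥0∞, 1 ≤ p → SchurBoundedLp μ ν m₁ m₂ k p) ↔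
      (SchurBoundedLp μ ν m₁ m₂ k 1 ∧ SchurBoundedLp μ ν m₁ m₂ k ⊤))
      ∧
    -- (b) ↔ (c)
    ((SchurBoundedLp μ ν m₁ m₂ k 1 ∧ SchurBoundedLp μ ν m₁ m₂ k ⊤) ↔
      (C₁ < ⊤ ∧ C₂ < ⊤))
      ∧
    -- quantitative bound when (c) holds
    (C₁ < ⊤ → C₂ < ⊤ → ∀ p : ℝ≥0∞, 1 ≤ p → ∀ f : X → ℂ,
      AEStronglyMeasurable f μ → eLpNorm (fun x => m₁ x • f x) p μ < ⊤ →
      (∀ᵐ y ∂ν, Integrable (fun x => k (x, y) * f x) μ) ∧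
      eLpNorm (fun y => m₂ y • ∫ x, k (x, y) * f x ∂μ) p ν
        ≤ C₂ ^ (1 / p).toReal * C₁ ^ (1 - (1 / p).toReal) *
          eLpNorm (fun x => m₁ x • f x) p μ) := by
  have h₁ : ∀ᵐ y ∂ν, ENNReal.ofReal (m₂ y) *
      ∫⁻ x, (‖k (x, y)‖₊ : ℝ≥0∞) * (ENNReal.ofReal (m₁ x))⁻¹ ∂μ ≤ C₁ := hC₁ ▸ ENNReal.ae_le_essSup _
  have h₂ : ∀ᵐ x ∂μ, (ENNReal.ofReal (m₁ x))⁻¹ *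
      ∫⁻ y, (‖k (x, y)‖₊ : ℝ≥0∞) * ENNReal.ofReal (m₂ y) ∂ν ≤ C₂ := hC₂ ▸ ENNReal.ae_le_essSup _
  have hquant := fun (hC₁lt : C₁ < ⊤) (hC₂lt : C₂ < ⊤) (p : ℝ≥0∞) (hp : 1 ≤ p) (f : X → ℂ)
    (hf : AEStronglyMeasurable f μ) (hfp : eLpNorm (fun x => m₁ x • f x) p μ < ⊤) =>
    integrable_and_eLpNorm_le_of_schur hm₁ hm₂ hm₁pos hm₂pos hk hC₁lt hC₂lt h₁ h₂ hp hf hfp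
  have hca : C₁ < ⊤ ∧ C₂ < ⊤ → ∀ p : ℝ≥0∞, 1 ≤ p → SchurBoundedLp μ ν m₁ m₂ k p := by
    rintro ⟨hC₁lt, hC₂lt⟩ p hp
    have hexp : 0 ≤ 1 - (1 / p).toReal := by
      rw [sub_nonneg]
      simpa using ENNReal.toReal_mono one_ne_top (ENNReal.inv_le_one.2 hp)
    exact ⟨_, mul_lt_top (rpow_lt_top_of_nonneg toReal_nonneg hC₂lt.ne)
      (rpow_lt_top_of_nonneg hexp hC₁lt.ne), hquant hC₁lt hC₂lt p hp⟩
  have hbc : SchurBoundedLp μ ν m₁ m₂ k 1 ∧ SchurBoundedLp μ ν m₁ m₂ k ⊤ → C₁ < ⊤ ∧ C₂ < ⊤ :=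
    fun h => ⟨hC₁ ▸ h.2.essSup_lt_top_of_top hm₁ hm₁pos hm₂pos hk,
      hC₂ ▸ h.1.essSup_lt_top_of_one hm₁ hm₂ hm₁pos hm₂pos hk⟩
  have hab : (∀ p : ℝ≥0∞, 1 ≤ p → SchurBoundedLp μ ν m₁ m₂ k p) →
      SchurBoundedLp μ ν m₁ m₂ k 1 ∧ SchurBoundedLp μ ν m₁ m₂ k ⊤ :=
    fun h => ⟨h 1 le_rfl, h ⊤ le_top⟩
  exact ⟨⟨hab, fun h => hca (hbc h)⟩, ⟨hbc, fun h => hab (hca h)⟩, hquant⟩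
end
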